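/- arXiv:2409.12779 — 9 statements merged into one kernel-verified Lean document; each statement's English description precedes it below -/
import Mathlib

section
/- The generators of the triangle group satisfy the torsion relations S_p^p = -I and U_q^q = -I, where I is the identity matrix in SL₂(ℝ). -/
open Matrix Real

/-- `SL(2,ℝ)`. -/
abbrev SL2R := Matrix.SpecialLinearGroup (Fin 2) ℝ

/-- The generator `S_p = [[0,-1],[1,2cos(π/p)]]` of the triangle group. -/
noncomputable def Sp (p : ℕ) : SL2R :=
  ⟨!![0, -1; 1, 2 * Real.cos (π / p)], by simp [Matrix.det_fin_two_of]⟩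

/-- The generator `U_q = [[2cos(π/q),-1],[1,0]]` of the triangle group. -/
noncomputable def Uq (q : ℕ) : SL2R :=
  ⟨!![2 * Real.cos (π / q), -1; 1, 0], by simp [Matrix.det_fin_two_of]⟩

/-- The triangle group `Γ_{p,q}`, the subgroup of `SL(2,ℝ)` generated by `S_p` and `U_q`. -/
noncomputable def TriangleGroup (p q : ℕ) : Subgroup SL2R :=
  Subgroup.closure {Sp p, Uq q}

/-- The sign `sgn(g)`: the sign of the lower-left entry if nonzero, otherwise
the sign of the lower-right entry. -/
noncomputable def sgn (g : SL2R) : ℝ :=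
  if (g : Matrix (Fin 2) (Fin 2) ℝ) 1 0 ≠ 0 then Real.sign ((g : Matrix (Fin 2) (Fin 2) ℝ) 1 0)
  else Real.sign ((g : Matrix (Fin 2) (Fin 2) ℝ) 1 1)

/-- Asai's cocycle `W(g₁,g₂) = (sgn g₁ + sgn g₂ - sgn(g₁g₂) - sgn g₁ · sgn g₂ · sgn(g₁g₂))/4`. -/
noncomputable def W (g₁ g₂ : SL2R) : ℝ :=
  (sgn g₁ + sgn g₂ - sgn (g₁ * g₂) - sgn g₁ * sgn g₂ * sgn (g₁ * g₂)) / 4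

/-- The Chebyshev-like polynomials `C_n`, with `C_0 = 0`, `C_1 = 1` and
`C_{n+1}(x) = 2x C_n(x) - C_{n-1}(x)`, evaluated at `x`; namely `C_n = U_{n-1}`
with `U` the Chebyshev polynomial of the second kind. -/
noncomputable def Cheb (n : ℤ) (x : ℝ) : ℝ :=
  (Polynomial.Chebyshev.U ℝ (n - 1)).eval x

/-- Powers of a matrix with characteristic polynomial `X² - 2 cos θ X + 1`. -/
theorem sin_smul_pow (M : Matrix (Fin 2) (Fin 2) ℝ) (θ : ℝ)
    (h : M * M = (2 * Real.cos θ) • M - 1) (n : ℕ) :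
    Real.sin θ • M ^ n = Real.sin (n * θ) • M - Real.sin (n * θ - θ) • 1 := by
  induction n with
  | zero => simp
  | succ n ih =>
    have e1 : Real.sin (((n + 1 : ℕ) : ℝ) * θ) =
        2 * Real.cos θ * Real.sin (n * θ) - Real.sin (n * θ - θ) := by
      push_cast
      rw [add_mul, one_mul, Real.sin_add, Real.sin_sub]; ring
    have e2 : ((n + 1 : ℕ) : ℝ) * θ - θ = n * θ := by push_cast; ring
    rw [pow_succ, ← smul_mul_assoc, ih, sub_mul, smul_mul_assoc, smul_mul_assoc, h, one_mul,
      e1, e2]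
    module

theorem pow_eq_neg_one_of_sq (M : Matrix (Fin 2) (Fin 2) ℝ) (n : ℕ) (hn : 2 ≤ n)
    (h : M * M = (2 * Real.cos (π / n)) • M - 1) : M ^ n = -1 := by
  have hn' : (2 : ℝ) ≤ n := by exact_mod_cast hn
  have hs : 0 < Real.sin (π / n) :=
    Real.sin_pos_of_pos_of_lt_pi (by positivity) (div_lt_self Real.pi_pos (by linarith))
  have h1 := sin_smul_pow M (π / n) h n
  rw [mul_div_cancel₀ _ (ne_of_gt (by linarith : (0 : ℝ) < n)), Real.sin_pi_sub, Real.sin_pi, zero_smul,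
    zero_sub, ← smul_neg] at h1
  exact smul_right_injective _ hs.ne' h1

/-- The torsion relations `S_p^p = -I` and `U_q^q = -I`. -/
theorem Sp_pow_p_eq_neg_one (p q : ℕ) (hp : 2 ≤ p) (hpq : p < q) (hco : Nat.Coprime p q) :
    Sp p ^ p = (-1 : SL2R) ∧ Uq q ^ q = (-1 : SL2R) := by
  constructor
  · apply Subtype.ext
    rw [Matrix.SpecialLinearGroup.coe_pow, Matrix.SpecialLinearGroup.coe_neg,
      Matrix.SpecialLinearGroup.coe_one]
    apply pow_eq_neg_one_of_sq _ p hp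
    ext i j
    fin_cases i <;> fin_cases j <;> simp [Sp, Matrix.mul_apply, Fin.sum_univ_two] <;> ring
  · apply Subtype.ext
    rw [Matrix.SpecialLinearGroup.coe_pow, Matrix.SpecialLinearGroup.coe_neg,
      Matrix.SpecialLinearGroup.coe_one]
    apply pow_eq_neg_one_of_sq _ q (by omega)
    ext i j
    fin_cases i <;> fin_cases j <;> simp [Uq, Matrix.mul_apply, Fin.sum_univ_two] <;> ring
end

section
/- The function W is a 2-cocycle on SL₂(ℝ): for all g₁, g₂, g₃ ∈ SL₂(ℝ), W(g₁g₂, g₃) + W(g₁, g₂) = W(g₁, g₂g₃) + W(g₂, g₃). -/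
open Matrix Real

lemma sgn_cases (g : SL2R) : sgn g = 1 ∨ sgn g = -1 := by
  have hd := g.det_coe
  rw [Matrix.det_fin_two] at hd
  unfold sgn
  split_ifs with h
  · rcases lt_or_gt_of_ne h with h | h
    · right; exact Real.sign_of_neg h
    · left; exact Real.sign_of_pos h
  · have h0 : g.1 1 0 = 0 := not_not.mp h
    have h1 : g.1 1 1 ≠ 0 := by
      intro h1
      rw [h0, h1] at hd
      norm_num at hd
    rcases lt_or_gt_of_ne h1 with h | h
    · right; exact Real.sign_of_neg h
    · left; exact Real.sign_of_pos h

lemma sign_mul_real (x y : ℝ) : Real.sign (x * y) = Real.sign x * Real.sign y := by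
  rcases lt_trichotomy x 0 with h | h | h <;> rcases lt_trichotomy y 0 with k | k | k <;>
    simp [h, k, Real.sign_of_neg, Real.sign_of_pos, mul_pos_of_neg_of_neg, mul_neg_of_neg_of_pos,
      mul_neg_of_pos_of_neg, mul_pos]

lemma sgn_ne (g : SL2R) (h : g.1 1 0 ≠ 0) : sgn g = Real.sign (g.1 1 0) := by
  unfold sgn
  rw [if_pos h]

lemma sgn_zero (g : SL2R) (h : g.1 1 0 = 0) : sgn g = Real.sign (g.1 1 1) := by
  unfold sgn
  rw [if_neg (not_not.mpr h)]

lemma mul10 (g h : SL2R) : (g * h).1 1 0 = g.1 1 0 * h.1 0 0 + g.1 1 1 * h.1 1 0 := by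
  simp [Matrix.mul_apply, Fin.sum_univ_two]

lemma mul11 (g h : SL2R) : (g * h).1 1 1 = g.1 1 0 * h.1 0 1 + g.1 1 1 * h.1 1 1 := by
  simp [Matrix.mul_apply, Fin.sum_univ_two]

lemma det_eq (g : SL2R) : g.1 0 0 * g.1 1 1 - g.1 0 1 * g.1 1 0 = 1 := by
  have hd := g.det_coe
  rwa [Matrix.det_fin_two] at hd

lemma sgn_mul_left (g h : SL2R) (hg : g.1 1 0 = 0) : sgn (g * h) = sgn g * sgn h := by
  have hd := det_eq g
  have h1 : g.1 1 1 ≠ 0 := by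
    intro h1
    rw [hg, h1] at hd
    norm_num at hd
  have e := mul10 g h
  have f := mul11 g h
  rw [hg, zero_mul, zero_add] at e f
  rw [sgn_zero g hg]
  by_cases k : h.1 1 0 = 0
  · rw [sgn_zero h k, sgn_zero (g * h) (by rw [e, k, mul_zero]), f, sign_mul_real]
  · rw [sgn_ne h k, sgn_ne (g * h) (by rw [e]; exact mul_ne_zero h1 k), e, sign_mul_real]

lemma sgn_mul_right (g h : SL2R) (hh : h.1 1 0 = 0) : sgn (g * h) = sgn g * sgn h := by
  by_cases k : g.1 1 0 = 0
  · exact sgn_mul_left g h k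
  have hd := det_eq h
  rw [hh, mul_zero, sub_zero] at hd
  have e := mul10 g h
  rw [hh, mul_zero, add_zero] at e
  have h0 : h.1 0 0 ≠ 0 := left_ne_zero_of_mul (hd ▸ one_ne_zero)
  have hs : Real.sign (h.1 0 0) = Real.sign (h.1 1 1) := by
    rcases lt_or_gt_of_ne h0 with h | h
    · rw [Real.sign_of_neg h, Real.sign_of_neg (by nlinarith)]
    · rw [Real.sign_of_pos h, Real.sign_of_pos (by nlinarith)]
  rw [sgn_zero h hh, sgn_ne g k, sgn_ne (g * h) (by rw [e]; exact mul_ne_zero k h0), e,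
    sign_mul_real, hs]

lemma sgn_inv (g : SL2R) (hg : g.1 1 0 ≠ 0) : sgn g⁻¹ = - sgn g := by
  have e : (g⁻¹).1 1 0 = - g.1 1 0 := by
    rw [Matrix.SpecialLinearGroup.SL2_inv_expl]; simp
  rw [sgn_ne g hg, sgn_ne _ (by rw [e]; exact neg_ne_zero.mpr hg), e, Real.sign_neg]

lemma plucker (g₁ g₂ g₃ : SL2R) :
    (g₁ * g₂ * g₃).1 1 0 * g₂.1 1 0 + g₁.1 1 0 * g₃.1 1 0
      = (g₁ * g₂).1 1 0 * (g₂ * g₃).1 1 0 := by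
  have hd := det_eq g₂
  rw [mul10 (g₁ * g₂), mul10 g₁ g₂, mul11 g₁ g₂, mul10 g₂ g₃]
  linear_combination (-(g₁.1 1 0 * g₃.1 1 0)) * hd

lemma key (g₁ g₂ g₃ : SL2R) :
    sgn (g₁ * g₂) * sgn g₃ * sgn (g₁ * g₂ * g₃) + sgn g₁ * sgn g₂ * sgn (g₁ * g₂)
      = sgn g₁ * sgn (g₂ * g₃) * sgn (g₁ * g₂ * g₃) + sgn g₂ * sgn g₃ * sgn (g₂ * g₃) := by
  have A1 := sgn_cases g₁
  have A2 := sgn_cases g₂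
  have A3 := sgn_cases g₃
  have A12 := sgn_cases (g₁ * g₂)
  have A23 := sgn_cases (g₂ * g₃)
  have A123 := sgn_cases (g₁ * g₂ * g₃)
  by_cases h1 : g₁.1 1 0 = 0
  · have e := sgn_mul_left g₁ g₂ h1
    have f := sgn_mul_left g₁ (g₂ * g₃) h1
    rw [← mul_assoc] at f
    rw [f, e]
    rcases A1 with a | a <;> rcases A2 with b | b <;> rcases A23 with c | c <;>
      rw [a, b, c] <;> ring
  by_cases h3 : g₃.1 1 0 = 0
  · have e := sgn_mul_right g₂ g₃ h3
    have f := sgn_mul_right (g₁ * g₂) g₃ h3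
    rw [f, e]
    rcases A3 with a | a <;> rcases A2 with b | b <;> rcases A12 with c | c <;>
      rw [a, b, c] <;> ring
  by_cases h2 : g₂.1 1 0 = 0
  · have e := sgn_mul_left g₂ g₃ h2
    have f := sgn_mul_right g₁ g₂ h2
    rw [f, e]
    rcases A3 with a | a <;> rcases A2 with b | b <;> rcases A1 with c | c <;>
      rw [a, b, c] <;> ring
  by_cases h12 : (g₁ * g₂).1 1 0 = 0
  · have e := sgn_mul_left (g₁ * g₂) g₃ h12
    have f := sgn_mul_right g₁⁻¹ (g₁ * g₂) h12
    rw [inv_mul_cancel_left, sgn_inv g₁ h1] at f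
    rw [e, f]
    rcases A3 with a | a <;> rcases A12 with b | b <;> rcases A1 with c | c <;>
      rw [a, b, c] <;> ring
  by_cases h23 : (g₂ * g₃).1 1 0 = 0
  · have e := sgn_mul_right g₁ (g₂ * g₃) h23
    have f := sgn_mul_left (g₂ * g₃) g₃⁻¹ h23
    rw [mul_inv_cancel_right, sgn_inv g₃ h3] at f
    rw [← mul_assoc] at e
    rw [e, f]
    rcases A3 with a | a <;> rcases A23 with b | b <;> rcases A1 with c | c <;>
      rw [a, b, c] <;> ring
  by_cases h123 : (g₁ * g₂ * g₃).1 1 0 = 0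
  · have e := sgn_mul_left (g₁ * g₂ * g₃) g₃⁻¹ h123
    have f := sgn_mul_right g₁⁻¹ (g₁ * g₂ * g₃) h123
    rw [mul_inv_cancel_right, sgn_inv g₃ h3] at e
    rw [mul_assoc g₁, inv_mul_cancel_left, sgn_inv g₁ h1, ← mul_assoc] at f
    rw [e, f]
    rcases A3 with a | a <;> rcases A123 with b | b <;> rcases A1 with c | c <;>
      rw [a, b, c] <;> ring
  -- generic case: the signs of the three products in the Plücker relation
  have P := plucker g₁ g₂ g₃
  have hx : sgn (g₁ * g₂ * g₃) * sgn g₂ = Real.sign ((g₁ * g₂ * g₃).1 1 0 * g₂.1 1 0) := by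
    rw [sign_mul_real, sgn_ne _ h123, sgn_ne _ h2]
  have hy : sgn g₁ * sgn g₃ = Real.sign (g₁.1 1 0 * g₃.1 1 0) := by
    rw [sign_mul_real, sgn_ne _ h1, sgn_ne _ h3]
  have hz : sgn (g₁ * g₂) * sgn (g₂ * g₃) = Real.sign ((g₁ * g₂).1 1 0 * (g₂ * g₃).1 1 0) := by
    rw [sign_mul_real, sgn_ne _ h12, sgn_ne _ h23]
  have nx := mul_ne_zero h123 h2
  have ny := mul_ne_zero h1 h3
  rw [← P] at hz
  generalize (g₁ * g₂ * g₃).1 1 0 * g₂.1 1 0 = x at *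
  generalize g₁.1 1 0 * g₃.1 1 0 = y at *
  have T : sgn (g₁ * g₂ * g₃) * sgn g₂ = sgn g₁ * sgn g₃ →
      sgn (g₁ * g₂) * sgn (g₂ * g₃) = sgn g₁ * sgn g₃ := by
    rw [hx, hy, hz]
    intro h
    rcases lt_or_gt_of_ne nx with i | i <;> rcases lt_or_gt_of_ne ny with j | j
    · rw [Real.sign_of_neg j, Real.sign_of_neg (by linarith)]
    · rw [Real.sign_of_neg i, Real.sign_of_pos j] at h
      norm_num at h
    · rw [Real.sign_of_pos i, Real.sign_of_neg j] at h
      norm_num at h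
    · rw [Real.sign_of_pos j, Real.sign_of_pos (by linarith)]
  clear hx hy hz
  rcases A1 with a | a <;> rcases A2 with b | b <;> rcases A3 with c | c <;>
    rcases A12 with d | d <;> rcases A23 with e | e <;> rcases A123 with f | f <;>
    rw [a, b, c, d, e, f] at T ⊢ <;>
    first | (norm_num; done) | (norm_num at T; done)

/-- `W` is a 2-cocycle on `SL(2,ℝ)`. -/
theorem W_cocycle (g₁ g₂ g₃ : SL2R) :
    W (g₁ * g₂) g₃ + W g₁ g₂ = W g₁ (g₂ * g₃) + W g₂ g₃ := by
  have h := key g₁ g₂ g₃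
  unfold W
  rw [← mul_assoc g₁ g₂ g₃]
  linear_combination (-1 / 4) * h
end

section
/- For every integer n with 0 < n < p one has sgn(S_p^n) = 1, while sgn(S_p^p) = -1; similarly, for every integer m with 0 < m < q one has sgn(U_q^m) = 1, while sgn(U_q^q) = -1. -/
open Matrix Real

lemma Sp_pow_entries (p n : ℕ) :
    ((Sp p ^ n : SL2R) : Matrix (Fin 2) (Fin 2) ℝ) 1 0 * Real.sin (π / p) = Real.sin (n * (π / p)) ∧
    ((Sp p ^ n : SL2R) : Matrix (Fin 2) (Fin 2) ℝ) 1 1 * Real.sin (π / p)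
      = Real.sin (n * (π / p)) * Real.cos (π / p) + Real.cos (n * (π / p)) * Real.sin (π / p) := by
  induction n with
  | zero => simp
  | succ n ih =>
    obtain ⟨h0, h1⟩ := ih
    have e : ((n + 1 : ℕ) : ℝ) * (π / p) = n * (π / p) + π / p := by push_cast; ring
    rw [e, Real.sin_add, Real.cos_add, pow_succ, Matrix.SpecialLinearGroup.coe_mul,
      Matrix.mul_apply, Matrix.mul_apply, Fin.sum_univ_two, Fin.sum_univ_two]
    have a : (Sp p : Matrix (Fin 2) (Fin 2) ℝ) = !![0, -1; 1, 2 * Real.cos (π / p)] := rfl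
    rw [a]
    generalize ((Sp p ^ n : SL2R) : Matrix (Fin 2) (Fin 2) ℝ) 1 0 = c at *
    generalize ((Sp p ^ n : SL2R) : Matrix (Fin 2) (Fin 2) ℝ) 1 1 = d at *
    have t := Real.sin_sq_add_cos_sq (π / p)
    simp only [Matrix.of_apply, Matrix.cons_val', Matrix.cons_val_zero, Matrix.cons_val_one,
      Matrix.cons_val_fin_one]
    constructor
    · linear_combination h1
    · linear_combination -h0 + 2 * Real.cos (π / p) * h1 + Real.sin (n * (π / p)) * t

lemma Uq_pow_entries (p n : ℕ) :
    ((Uq p ^ n : SL2R) : Matrix (Fin 2) (Fin 2) ℝ) 1 0 * Real.sin (π / p) = Real.sin (n * (π / p)) ∧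
    ((Uq p ^ n : SL2R) : Matrix (Fin 2) (Fin 2) ℝ) 1 1 * Real.sin (π / p)
      = Real.cos (n * (π / p)) * Real.sin (π / p) - Real.sin (n * (π / p)) * Real.cos (π / p) := by
  induction n with
  | zero => simp
  | succ n ih =>
    obtain ⟨h0, h1⟩ := ih
    have e : ((n + 1 : ℕ) : ℝ) * (π / p) = n * (π / p) + π / p := by push_cast; ring
    rw [e, Real.sin_add, Real.cos_add, pow_succ, Matrix.SpecialLinearGroup.coe_mul,
      Matrix.mul_apply, Matrix.mul_apply, Fin.sum_univ_two, Fin.sum_univ_two]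
    have a : (Uq p : Matrix (Fin 2) (Fin 2) ℝ) = !![2 * Real.cos (π / p), -1; 1, 0] := rfl
    rw [a]
    generalize ((Uq p ^ n : SL2R) : Matrix (Fin 2) (Fin 2) ℝ) 1 0 = c at *
    generalize ((Uq p ^ n : SL2R) : Matrix (Fin 2) (Fin 2) ℝ) 1 1 = d at *
    have t := Real.sin_sq_add_cos_sq (π / p)
    simp only [Matrix.of_apply, Matrix.cons_val', Matrix.cons_val_zero, Matrix.cons_val_one,
      Matrix.cons_val_fin_one]
    constructor
    · linear_combination 2 * Real.cos (π / p) * h0 + h1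
    · linear_combination -h0 + Real.sin (n * (π / p)) * t

lemma sin_pi_div_pos (p : ℕ) (hp : 2 ≤ p) : 0 < Real.sin (π / p) := by
  have h : (2 : ℝ) ≤ p := by exact_mod_cast hp
  apply Real.sin_pos_of_pos_of_lt_pi
  · positivity
  · exact div_lt_self Real.pi_pos (by linarith)

lemma sgn_one_aux (g : SL2R) (p : ℕ) (hp : 2 ≤ p) (n : ℤ) (hn : 0 < n) (hnp : n < p)
    (h : (g : Matrix (Fin 2) (Fin 2) ℝ) 1 0 * Real.sin (π / p) = Real.sin (n * (π / p))) :
    sgn g = 1 := by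
  have hs := sin_pi_div_pos p hp
  have hp0 : (0 : ℝ) < p := by exact_mod_cast (by omega : 0 < p)
  have hn' : (0 : ℝ) < n := by exact_mod_cast hn
  have hnp' : (n : ℝ) < p := by exact_mod_cast hnp
  have h2 : 0 < Real.sin (n * (π / p)) := by
    apply Real.sin_pos_of_pos_of_lt_pi
    · positivity
    · rw [← mul_div_assoc, div_lt_iff₀ hp0]
      nlinarith [Real.pi_pos]
  rw [← h] at h2
  have h3 := pos_of_mul_pos_left h2 hs.le
  rw [sgn, if_pos h3.ne', Real.sign_of_pos h3]

lemma sgn_neg_aux (g : SL2R) (p : ℕ) (hp : 2 ≤ p)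
    (h : (g : Matrix (Fin 2) (Fin 2) ℝ) 1 0 * Real.sin (π / p) = 0)
    (h' : (g : Matrix (Fin 2) (Fin 2) ℝ) 1 1 * Real.sin (π / p) = - Real.sin (π / p)) :
    sgn g = -1 := by
  have hs := sin_pi_div_pos p hp
  have h0 := (mul_eq_zero.1 h).resolve_right hs.ne'
  have h1 : (g : Matrix (Fin 2) (Fin 2) ℝ) 1 1 = -1 := by
    apply mul_right_cancel₀ hs.ne'
    linarith
  rw [sgn, if_neg (by simpa using h0), h1, Real.sign_of_neg (by norm_num)]

/-- Sign values of powers of the generators: `sgn(S_p^n) = 1` for `0 < n < p`,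
`sgn(S_p^p) = -1`, and similarly for `U_q`. -/
theorem sgn_pow_gen (p q : ℕ) (hp : 2 ≤ p) (hpq : p < q) (hco : Nat.Coprime p q) :
    (∀ n : ℤ, 0 < n → n < p → sgn (Sp p ^ n) = 1) ∧ sgn (Sp p ^ (p : ℤ)) = -1 ∧
    (∀ m : ℤ, 0 < m → m < q → sgn (Uq q ^ m) = 1) ∧ sgn (Uq q ^ (q : ℤ)) = -1 := by
  have hq : 2 ≤ q := by omega
  have key : ∀ r : ℕ, 2 ≤ r → (r : ℝ) * (π / r) = π := by
    intro r hr
    have : (r : ℝ) ≠ 0 := by exact_mod_cast (by omega : r ≠ 0)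
    field_simp
  refine ⟨?_, ?_, ?_, ?_⟩
  · intro n hn hnp
    lift n to ℕ using hn.le
    apply sgn_one_aux _ p hp n hn hnp
    rw [zpow_natCast]
    exact_mod_cast (Sp_pow_entries p n).1
  · have h := Sp_pow_entries p p
    rw [key p hp, Real.sin_pi, Real.cos_pi] at h
    rw [zpow_natCast]
    exact sgn_neg_aux _ p hp h.1 (by rw [h.2]; ring)
  · intro n hn hnp
    lift n to ℕ using hn.le
    apply sgn_one_aux _ q hq n hn hnp
    rw [zpow_natCast]
    exact_mod_cast (Uq_pow_entries q n).1
  · have h := Uq_pow_entries q q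
    rw [key q hq, Real.sin_pi, Real.cos_pi] at h
    rw [zpow_natCast]
    exact sgn_neg_aux _ q hq h.1 (by rw [h.2]; ring)
end

section
/- For every integer n with 0 < n < p, W(S_p, S_p^n) = 1 if n = p - 1 and W(S_p, S_p^n) = 0 if 0 < n < p - 1; similarly, for every integer m with 0 < m < q, W(U_q, U_q^m) = 1 if m = q - 1 and W(U_q, U_q^m) = 0 if 0 < m < q - 1. -/
open Matrix Real

theorem Sp_pow_row (p n : ℕ) :
    ((Sp p ^ n : SL2R) : Matrix (Fin 2) (Fin 2) ℝ) 1 0 * Real.sin (π / p) = Real.sin (n * (π / p)) ∧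
    ((Sp p ^ n : SL2R) : Matrix (Fin 2) (Fin 2) ℝ) 1 1 * Real.sin (π / p)
      = Real.sin ((n + 1) * (π / p)) := by
  induction n with
  | zero => simp
  | succ k ih =>
    obtain ⟨h1, h2⟩ := ih
    have e0 : ((Sp p ^ (k+1) : SL2R) : Matrix (Fin 2) (Fin 2) ℝ) 1 0
        = ((Sp p ^ k : SL2R) : Matrix (Fin 2) (Fin 2) ℝ) 1 1 := by
      rw [pow_succ, Matrix.SpecialLinearGroup.coe_mul, Matrix.mul_apply, Fin.sum_univ_two]
      simp [Sp]
    have e1 : ((Sp p ^ (k+1) : SL2R) : Matrix (Fin 2) (Fin 2) ℝ) 1 1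
        = -((Sp p ^ k : SL2R) : Matrix (Fin 2) (Fin 2) ℝ) 1 0
          + ((Sp p ^ k : SL2R) : Matrix (Fin 2) (Fin 2) ℝ) 1 1 * (2 * Real.cos (π / p)) := by
      rw [pow_succ, Matrix.SpecialLinearGroup.coe_mul, Matrix.mul_apply, Fin.sum_univ_two]
      simp [Sp]
    rw [e0, e1]
    push_cast
    refine ⟨h2, ?_⟩
    have a : ((k:ℝ) + 1 + 1) * (π / p) = (k + 1) * (π / p) + π / p := by ring
    have b : (k:ℝ) * (π / p) = (k + 1) * (π / p) - π / p := by ring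
    rw [b, Real.sin_sub] at h1
    rw [a, Real.sin_add]
    linear_combination -h1 + 2 * Real.cos (π / p) * h2

theorem Uq_pow_row (p n : ℕ) :
    ((Uq p ^ n : SL2R) : Matrix (Fin 2) (Fin 2) ℝ) 1 0 * Real.sin (π / p) = Real.sin (n * (π / p)) ∧
    ((Uq p ^ n : SL2R) : Matrix (Fin 2) (Fin 2) ℝ) 1 1 * Real.sin (π / p)
      = -Real.sin ((n - 1) * (π / p)) := by
  induction n with
  | zero => simp
  | succ k ih =>
    obtain ⟨h1, h2⟩ := ih
    have e0 : ((Uq p ^ (k+1) : SL2R) : Matrix (Fin 2) (Fin 2) ℝ) 1 1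
        = -((Uq p ^ k : SL2R) : Matrix (Fin 2) (Fin 2) ℝ) 1 0 := by
      rw [pow_succ, Matrix.SpecialLinearGroup.coe_mul, Matrix.mul_apply, Fin.sum_univ_two]
      simp [Uq]
    have e1 : ((Uq p ^ (k+1) : SL2R) : Matrix (Fin 2) (Fin 2) ℝ) 1 0
        = ((Uq p ^ k : SL2R) : Matrix (Fin 2) (Fin 2) ℝ) 1 0 * (2 * Real.cos (π / p))
          + ((Uq p ^ k : SL2R) : Matrix (Fin 2) (Fin 2) ℝ) 1 1 := by
      rw [pow_succ, Matrix.SpecialLinearGroup.coe_mul, Matrix.mul_apply, Fin.sum_univ_two]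
      simp [Uq]
    rw [e0, e1]
    push_cast
    have a : ((k:ℝ) + 1) * (π / p) = k * (π / p) + π / p := by ring
    have b : ((k:ℝ) - 1) * (π / p) = k * (π / p) - π / p := by ring
    have c : ((k:ℝ) + 1 - 1) * (π / p) = k * (π / p) := by ring
    rw [b, Real.sin_sub] at h2
    rw [a, c, Real.sin_add]
    constructor
    · linear_combination h2 + 2 * Real.cos (π / p) * h1
    · linear_combination -h1

theorem sin_mul_pos (p n : ℕ) (h0 : 0 < n) (h1 : n < p) : 0 < Real.sin (n * (π / p)) := by
  have hp : (0:ℝ) < p := by exact_mod_cast h0.trans h1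
  have hn : (0:ℝ) < n := by exact_mod_cast h0
  have hnp : (n:ℝ) < p := by exact_mod_cast h1
  apply Real.sin_pos_of_pos_of_lt_pi
  · positivity
  · rw [← mul_div_assoc, div_lt_iff₀ hp, mul_comm π]
    exact mul_lt_mul_of_pos_right hnp Real.pi_pos

theorem sgn_eq_one_of (g : SL2R) (s t : ℝ) (hs : 0 < s) (ht : 0 < t)
    (h : (g : Matrix (Fin 2) (Fin 2) ℝ) 1 0 * s = t) : sgn g = 1 := by
  have : 0 < (g : Matrix (Fin 2) (Fin 2) ℝ) 1 0 := pos_of_mul_pos_left (h ▸ ht) hs.le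
  rw [sgn, if_pos this.ne', Real.sign_of_pos this]

theorem sgn_eq_neg_one_of (g : SL2R) (s : ℝ) (hs : 0 < s)
    (h : (g : Matrix (Fin 2) (Fin 2) ℝ) 1 0 * s = 0)
    (h' : (g : Matrix (Fin 2) (Fin 2) ℝ) 1 1 * s = -s) : sgn g = -1 := by
  have h0 : (g : Matrix (Fin 2) (Fin 2) ℝ) 1 0 = 0 := by
    rcases mul_eq_zero.1 h with h | h
    · exact h
    · exact absurd h hs.ne'
  have : (g : Matrix (Fin 2) (Fin 2) ℝ) 1 1 < 0 := by
    by_contra hc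
    push Not at hc
    have := mul_nonneg hc hs.le
    linarith
  rw [sgn, if_neg (by simp [h0]), Real.sign_of_neg this]

theorem W_of_sgn (g : SL2R) (p : ℕ) (hp : 2 ≤ p) (h1 : ∀ n : ℕ, 0 < n → n < p → sgn (g ^ n) = 1)
    (h2 : sgn (g ^ p) = -1) (n : ℤ) (h0 : 0 < n) (hn : n < p) :
    (n = p - 1 → W g (g ^ n) = 1) ∧ (n < p - 1 → W g (g ^ n) = 0) := by
  lift n to ℕ using h0.le
  have hg : sgn g = 1 := by simpa using h1 1 one_pos (by omega)
  have hgn : sgn (g ^ n) = 1 := h1 n (by omega) (by omega)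
  rw [zpow_natCast, W, ← pow_succ', hg, hgn]
  constructor
  · intro h
    have : n + 1 = p := by omega
    rw [this, h2]
    norm_num
  · intro h
    rw [h1 (n + 1) (by omega) (by omega)]
    norm_num

theorem W_Sp_pow (p : ℕ) (hp : 2 ≤ p) (n : ℤ) (h0 : 0 < n) (hn : n < p) :
    (n = p - 1 → W (Sp p) (Sp p ^ n) = 1) ∧ (n < p - 1 → W (Sp p) (Sp p ^ n) = 0) := by
  have hs : 0 < Real.sin (π / p) := by simpa using sin_mul_pos p 1 one_pos (by omega)
  have hp0 : (p:ℝ) ≠ 0 := by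
    have : p ≠ 0 := by omega
    exact_mod_cast this
  have e : (p:ℝ) * (π / p) = π := by field_simp
  refine W_of_sgn _ p hp (fun k hk hkp => ?_) ?_ n h0 hn
  · exact sgn_eq_one_of _ _ _ hs (sin_mul_pos p k hk hkp) (Sp_pow_row p k).1
  · refine sgn_eq_neg_one_of _ _ hs ?_ ?_
    · rw [(Sp_pow_row p p).1, e, Real.sin_pi]
    · rw [(Sp_pow_row p p).2, add_mul, e, one_mul, add_comm, Real.sin_add_pi]

theorem W_Uq_pow (p : ℕ) (hp : 2 ≤ p) (n : ℤ) (h0 : 0 < n) (hn : n < p) :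
    (n = p - 1 → W (Uq p) (Uq p ^ n) = 1) ∧ (n < p - 1 → W (Uq p) (Uq p ^ n) = 0) := by
  have hs : 0 < Real.sin (π / p) := by simpa using sin_mul_pos p 1 one_pos (by omega)
  have hp0 : (p:ℝ) ≠ 0 := by
    have : p ≠ 0 := by omega
    exact_mod_cast this
  have e : (p:ℝ) * (π / p) = π := by field_simp
  refine W_of_sgn _ p hp (fun k hk hkp => ?_) ?_ n h0 hn
  · exact sgn_eq_one_of _ _ _ hs (sin_mul_pos p k hk hkp) (Uq_pow_row p k).1
  · refine sgn_eq_neg_one_of _ _ hs ?_ ?_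
    · rw [(Uq_pow_row p p).1, e, Real.sin_pi]
    · rw [(Uq_pow_row p p).2, sub_mul, e, one_mul, Real.sin_pi_sub]

/-- Values of `W(S_p, S_p^n)` for `0 < n < p` and of `W(U_q, U_q^m)` for `0 < m < q`. -/
theorem W_gen_pow (p q : ℕ) (hp : 2 ≤ p) (hpq : p < q) (hco : Nat.Coprime p q) :
    (∀ n : ℤ, 0 < n → n < p →
      (n = p - 1 → W (Sp p) (Sp p ^ n) = 1) ∧ (n < p - 1 → W (Sp p) (Sp p ^ n) = 0)) ∧
    (∀ m : ℤ, 0 < m → m < q →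
      (m = q - 1 → W (Uq q) (Uq q ^ m) = 1) ∧ (m < q - 1 → W (Uq q) (Uq q ^ m) = 0)) := by
  exact ⟨fun n h0 hn => W_Sp_pow p hp n h0 hn, fun m h0 hm => W_Uq_pow q (by omega) m h0 hm⟩
end

section
/- For all integers n, m, the product S_p^n U_q^m equals the matrix [[-C_{n-1}(s)C_{m+1}(u) - C_n(s)C_m(u), C_{n-1}(s)C_m(u) + C_n(s)C_{m-1}(u)], [C_n(s)C_{m+1}(u) + C_{n+1}(s)C_m(u), -C_n(s)C_m(u) - C_{n+1}(s)C_{m-1}(u)]], where s = cos(π/p) and u = cos(π/q). -/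
open Matrix Real

theorem Cheb_rec (n : ℤ) (x : ℝ) : Cheb (n + 1) x = 2 * x * Cheb n x - Cheb (n - 1) x := by
  have h := congrArg (Polynomial.eval x) (Polynomial.Chebyshev.U_add_two ℝ (n - 2))
  simp only [Polynomial.eval_sub, Polynomial.eval_mul, Polynomial.eval_ofNat,
    Polynomial.eval_X] at h
  unfold Cheb
  rw [show n + 1 - 1 = n - 2 + 2 by ring, show n - 1 - 1 = n - 2 by ring,
    show n - 1 = n - 2 + 1 by ring]
  exact h

theorem Cheb_zero (x : ℝ) : Cheb 0 x = 0 := by simp [Cheb]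

theorem Cheb_one (x : ℝ) : Cheb 1 x = 1 := by simp [Cheb]

theorem Cheb_neg_one (x : ℝ) : Cheb (-1) x = -1 := by
  have h := Cheb_rec 0 x
  norm_num [Cheb_zero, Cheb_one] at h
  linarith

theorem Sp_zpow (p : ℕ) (n : ℤ) : ((Sp p ^ n : SL2R) : Matrix (Fin 2) (Fin 2) ℝ) =
    !![-Cheb (n - 1) (Real.cos (π / p)), -Cheb n (Real.cos (π / p));
       Cheb n (Real.cos (π / p)), Cheb (n + 1) (Real.cos (π / p))] := by
  induction n using Int.induction_on with
  | zero =>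
    ext i j
    fin_cases i <;> fin_cases j <;> simp [Cheb_zero, Cheb_one, Cheb_neg_one]
  | succ k ih =>
    have h1 := Cheb_rec k (Real.cos (π / p))
    have h2 := Cheb_rec (k + 1) (Real.cos (π / p))
    rw [_root_.zpow_add_one, Matrix.SpecialLinearGroup.coe_mul, ih]
    rw [add_sub_cancel_right] at h2 ⊢
    ext i j
    fin_cases i <;> fin_cases j <;> simp [Sp, Matrix.mul_apply, Fin.sum_univ_two] <;> linarith
  | pred k ih =>
    have h1 := Cheb_rec (-k) (Real.cos (π / p))
    have h2 := Cheb_rec (-k - 1) (Real.cos (π / p))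
    rw [_root_.zpow_sub_one, Matrix.SpecialLinearGroup.coe_mul, ih,
      Matrix.SpecialLinearGroup.coe_inv, Matrix.adjugate_fin_two]
    rw [sub_add_cancel] at h2 ⊢
    ext i j
    fin_cases i <;> fin_cases j <;>
      simp [Sp, Matrix.mul_apply, Fin.sum_univ_two] <;> linarith

theorem Uq_zpow (q : ℕ) (n : ℤ) : ((Uq q ^ n : SL2R) : Matrix (Fin 2) (Fin 2) ℝ) =
    !![Cheb (n + 1) (Real.cos (π / q)), -Cheb n (Real.cos (π / q));
       Cheb n (Real.cos (π / q)), -Cheb (n - 1) (Real.cos (π / q))] := by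
  induction n using Int.induction_on with
  | zero =>
    ext i j
    fin_cases i <;> fin_cases j <;> simp [Cheb_zero, Cheb_one, Cheb_neg_one]
  | succ k ih =>
    have h1 := Cheb_rec k (Real.cos (π / q))
    have h2 := Cheb_rec (k + 1) (Real.cos (π / q))
    rw [_root_.zpow_add_one, Matrix.SpecialLinearGroup.coe_mul, ih]
    rw [add_sub_cancel_right] at h2 ⊢
    ext i j
    fin_cases i <;> fin_cases j <;> simp [Uq, Matrix.mul_apply, Fin.sum_univ_two] <;> linarith
  | pred k ih =>
    have h1 := Cheb_rec (-k) (Real.cos (π / q))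
    have h2 := Cheb_rec (-k - 1) (Real.cos (π / q))
    rw [_root_.zpow_sub_one, Matrix.SpecialLinearGroup.coe_mul, ih,
      Matrix.SpecialLinearGroup.coe_inv, Matrix.adjugate_fin_two]
    rw [sub_add_cancel] at h2 ⊢
    ext i j
    fin_cases i <;> fin_cases j <;>
      simp [Uq, Matrix.mul_apply, Fin.sum_univ_two] <;> linarith

/-- Explicit entries of `S_p^n U_q^m` in terms of the Chebyshev values
`C_k(s)`, `C_k(u)` with `s = cos(π/p)` and `u = cos(π/q)`. -/
theorem Sp_zpow_mul_Uq_zpow (p q : ℕ) (hp : 2 ≤ p) (hpq : p < q) (hco : Nat.Coprime p q)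
    (n m : ℤ) :
    ((Sp p ^ n * Uq q ^ m : SL2R) : Matrix (Fin 2) (Fin 2) ℝ) =
      !![-Cheb (n - 1) (Real.cos (π / p)) * Cheb (m + 1) (Real.cos (π / q))
           - Cheb n (Real.cos (π / p)) * Cheb m (Real.cos (π / q)),
         Cheb (n - 1) (Real.cos (π / p)) * Cheb m (Real.cos (π / q))
           + Cheb n (Real.cos (π / p)) * Cheb (m - 1) (Real.cos (π / q));
         Cheb n (Real.cos (π / p)) * Cheb (m + 1) (Real.cos (π / q))
           + Cheb (n + 1) (Real.cos (π / p)) * Cheb m (Real.cos (π / q)),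
         -Cheb n (Real.cos (π / p)) * Cheb m (Real.cos (π / q))
           - Cheb (n + 1) (Real.cos (π / p)) * Cheb (m - 1) (Real.cos (π / q))] := by
  rw [Matrix.SpecialLinearGroup.coe_mul, Sp_zpow, Uq_zpow]
  ext i j
  fin_cases i <;> fin_cases j <;> simp [Matrix.mul_apply, Fin.sum_univ_two] <;> ring
end

section
/- Let r ≥ 1 and let M = [[a, b], [c, d]] = S_p^{n₁} U_q^{m₁} ⋯ S_p^{n_r} U_q^{m_r}, where 0 < n_j < p and 0 < m_j < q for all 1 ≤ j ≤ r. If r is odd, then a < 0, d < 0, b ≥ 0, and c ≥ 0; if r is even, then a > 0, d > 0, b ≤ 0, and c ≤ 0. -/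
open Matrix Real

lemma SL2R_coe_mul (A B : SL2R) : ((A * B : SL2R) : Matrix (Fin 2) (Fin 2) ℝ) =
    (A : Matrix (Fin 2) (Fin 2) ℝ) * (B : Matrix (Fin 2) (Fin 2) ℝ) := rfl

lemma Sp_pow_mul_sin (p k : ℕ) :
    ((Sp p ^ k : SL2R) : Matrix (Fin 2) (Fin 2) ℝ) 0 0 * sin (π / p) = -sin ((k - 1) * (π / p)) ∧
    ((Sp p ^ k : SL2R) : Matrix (Fin 2) (Fin 2) ℝ) 0 1 * sin (π / p) = -sin (k * (π / p)) ∧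
    ((Sp p ^ k : SL2R) : Matrix (Fin 2) (Fin 2) ℝ) 1 0 * sin (π / p) = sin (k * (π / p)) ∧
    ((Sp p ^ k : SL2R) : Matrix (Fin 2) (Fin 2) ℝ) 1 1 * sin (π / p) = sin ((k + 1) * (π / p)) := by
  induction k with
  | zero => simp
  | succ k ih =>
    obtain ⟨h1, h2, h3, h4⟩ := ih
    rw [pow_succ]
    simp only [SL2R_coe_mul, Matrix.mul_apply, Fin.sum_univ_two]
    generalize ((Sp p ^ k : SL2R) : Matrix (Fin 2) (Fin 2) ℝ) = A at *
    simp only [Sp, Matrix.of_apply, Matrix.cons_val', Matrix.cons_val_zero, Matrix.cons_val_one,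
      Matrix.cons_val_fin_one]
    generalize π / (p : ℝ) = α at *
    have e1 : sin (((k + 1 : ℕ) + 1 : ℝ) * α) = 2 * cos α * sin ((k + 1) * α) - sin (k * α) := by
      have a : (((k + 1 : ℕ) + 1 : ℝ) * α) = (k + 1) * α + α := by push_cast; ring
      have b : ((k : ℝ) * α) = (k + 1) * α - α := by ring
      rw [a, b, sin_add, sin_sub]; ring
    have e2 : sin (((k : ℝ) + 1) * α) = 2 * cos α * sin (k * α) - sin ((k - 1) * α) := by
      have a : (((k : ℝ) + 1) * α) = k * α + α := by ring
      have b : (((k : ℝ) - 1) * α) = k * α - α := by ring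
      rw [a, b, sin_add, sin_sub]; ring
    have e3 : ((k + 1 : ℕ) : ℝ) = k + 1 := by push_cast; ring
    have e4 : (k : ℝ) + 1 - 1 = k := by ring
    rw [e1, e3, e4]
    refine ⟨?_, ?_, ?_, ?_⟩
    · linear_combination h2
    · rw [e2]; linear_combination -h1 + 2 * cos α * h2
    · linear_combination h4
    · linear_combination -h3 + 2 * cos α * h4

lemma Uq_pow_mul_sin (p k : ℕ) :
    ((Uq p ^ k : SL2R) : Matrix (Fin 2) (Fin 2) ℝ) 0 0 * sin (π / p) = sin ((k + 1) * (π / p)) ∧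
    ((Uq p ^ k : SL2R) : Matrix (Fin 2) (Fin 2) ℝ) 0 1 * sin (π / p) = -sin (k * (π / p)) ∧
    ((Uq p ^ k : SL2R) : Matrix (Fin 2) (Fin 2) ℝ) 1 0 * sin (π / p) = sin (k * (π / p)) ∧
    ((Uq p ^ k : SL2R) : Matrix (Fin 2) (Fin 2) ℝ) 1 1 * sin (π / p) = -sin ((k - 1) * (π / p)) := by
  induction k with
  | zero => simp
  | succ k ih =>
    obtain ⟨h1, h2, h3, h4⟩ := ih
    rw [pow_succ]
    simp only [SL2R_coe_mul, Matrix.mul_apply, Fin.sum_univ_two]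
    generalize ((Uq p ^ k : SL2R) : Matrix (Fin 2) (Fin 2) ℝ) = A at *
    simp only [Uq, Matrix.of_apply, Matrix.cons_val', Matrix.cons_val_zero, Matrix.cons_val_one,
      Matrix.cons_val_fin_one]
    generalize π / (p : ℝ) = α at *
    have e1 : sin (((k + 1 : ℕ) + 1 : ℝ) * α) = 2 * cos α * sin ((k + 1) * α) - sin (k * α) := by
      have a : (((k + 1 : ℕ) + 1 : ℝ) * α) = (k + 1) * α + α := by push_cast; ring
      have b : ((k : ℝ) * α) = (k + 1) * α - α := by ring
      rw [a, b, sin_add, sin_sub]; ring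
    have e2 : sin (((k : ℝ) + 1) * α) = 2 * cos α * sin (k * α) - sin ((k - 1) * α) := by
      have a : (((k : ℝ) + 1) * α) = k * α + α := by ring
      have b : (((k : ℝ) - 1) * α) = k * α - α := by ring
      rw [a, b, sin_add, sin_sub]; ring
    have e3 : ((k + 1 : ℕ) : ℝ) = k + 1 := by push_cast; ring
    have e4 : (k : ℝ) + 1 - 1 = k := by ring
    rw [e1, e3, e4]
    refine ⟨?_, ?_, ?_, ?_⟩
    · linear_combination h2 + 2 * cos α * h1
    · linear_combination -h1
    · rw [e2]; linear_combination h4 + 2 * cos α * h3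
    · linear_combination -h3

lemma sin_mul_pos_aux (p : ℕ) (hp : 2 ≤ p) (x : ℝ) (h0 : 0 < x) (h1 : x < p) :
    0 < sin (x * (π / p)) := by
  have hp' : (0 : ℝ) < p := by positivity
  apply sin_pos_of_pos_of_lt_pi
  · positivity
  · rw [mul_div_assoc', div_lt_iff₀ hp']; nlinarith [pi_pos]

lemma sin_mul_nonneg_aux (p : ℕ) (hp : 2 ≤ p) (x : ℝ) (h0 : 0 ≤ x) (h1 : x ≤ p) :
    0 ≤ sin (x * (π / p)) := by
  have hp' : (0 : ℝ) < p := by positivity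
  apply sin_nonneg_of_nonneg_of_le_pi
  · positivity
  · rw [mul_div_assoc', div_le_iff₀ hp']; nlinarith [pi_pos]

lemma sin_pack (p : ℕ) (hp : 2 ≤ p) (k : ℕ) (h0 : 0 < k) (h1 : k < p) :
    0 < sin (π / p) ∧ 0 < sin (k * (π / p)) ∧ 0 ≤ sin ((k - 1) * (π / p)) ∧
    0 ≤ sin ((k + 1) * (π / p)) := by
  have a : (1 : ℝ) ≤ k := by exact_mod_cast h0
  have b : (k : ℝ) + 1 ≤ p := by exact_mod_cast h1
  refine ⟨?_, sin_mul_pos_aux p hp _ (by linarith) (by linarith),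
    sin_mul_nonneg_aux p hp _ (by linarith) (by linarith),
    sin_mul_nonneg_aux p hp _ (by linarith) (by linarith)⟩
  have := sin_mul_pos_aux p hp 1 (by norm_num) (by linarith)
  simpa using this

lemma Sp_signs (p : ℕ) (hp : 2 ≤ p) (n : ℤ) (h0 : 0 < n) (h1 : n < p) :
    ((Sp p ^ n : SL2R) : Matrix (Fin 2) (Fin 2) ℝ) 0 0 ≤ 0 ∧
    ((Sp p ^ n : SL2R) : Matrix (Fin 2) (Fin 2) ℝ) 0 1 < 0 ∧
    0 < ((Sp p ^ n : SL2R) : Matrix (Fin 2) (Fin 2) ℝ) 1 0 ∧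
    0 ≤ ((Sp p ^ n : SL2R) : Matrix (Fin 2) (Fin 2) ℝ) 1 1 := by
  lift n to ℕ using h0.le
  rw [zpow_natCast]
  obtain ⟨s, s0, sm, sp⟩ := sin_pack p hp n (by exact_mod_cast h0) (by exact_mod_cast h1)
  obtain ⟨a, b, c, d⟩ := Sp_pow_mul_sin p n
  refine ⟨?_, ?_, ?_, ?_⟩
  · by_contra! h; nlinarith
  · by_contra! h; nlinarith
  · by_contra! h; nlinarith
  · by_contra! h; nlinarith

lemma Uq_signs (p : ℕ) (hp : 2 ≤ p) (n : ℤ) (h0 : 0 < n) (h1 : n < p) :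
    0 ≤ ((Uq p ^ n : SL2R) : Matrix (Fin 2) (Fin 2) ℝ) 0 0 ∧
    ((Uq p ^ n : SL2R) : Matrix (Fin 2) (Fin 2) ℝ) 0 1 < 0 ∧
    0 < ((Uq p ^ n : SL2R) : Matrix (Fin 2) (Fin 2) ℝ) 1 0 ∧
    ((Uq p ^ n : SL2R) : Matrix (Fin 2) (Fin 2) ℝ) 1 1 ≤ 0 := by
  lift n to ℕ using h0.le
  rw [zpow_natCast]
  obtain ⟨s, s0, sm, sp⟩ := sin_pack p hp n (by exact_mod_cast h0) (by exact_mod_cast h1)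
  obtain ⟨a, b, c, d⟩ := Uq_pow_mul_sin p n
  refine ⟨?_, ?_, ?_, ?_⟩
  · by_contra! h; nlinarith
  · by_contra! h; nlinarith
  · by_contra! h; nlinarith
  · by_contra! h; nlinarith

lemma block_signs (p q : ℕ) (hp : 2 ≤ p) (hq : 2 ≤ q) (n m : ℤ) (hn : 0 < n ∧ n < p)
    (hm : 0 < m ∧ m < q) :
    ((Sp p ^ n * Uq q ^ m : SL2R) : Matrix (Fin 2) (Fin 2) ℝ) 0 0 < 0 ∧
    ((Sp p ^ n * Uq q ^ m : SL2R) : Matrix (Fin 2) (Fin 2) ℝ) 1 1 < 0 ∧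
    0 ≤ ((Sp p ^ n * Uq q ^ m : SL2R) : Matrix (Fin 2) (Fin 2) ℝ) 0 1 ∧
    0 ≤ ((Sp p ^ n * Uq q ^ m : SL2R) : Matrix (Fin 2) (Fin 2) ℝ) 1 0 := by
  obtain ⟨a, b, c, d⟩ := Sp_signs p hp n hn.1 hn.2
  obtain ⟨a', b', c', d'⟩ := Uq_signs q hq m hm.1 hm.2
  simp only [SL2R_coe_mul, Matrix.mul_apply, Fin.sum_univ_two]
  refine ⟨?_, ?_, ?_, ?_⟩ <;> nlinarith

lemma prod_signs (p q : ℕ) (hp : 2 ≤ p) (hq : 2 ≤ q) (r : ℕ) (n m : ℕ → ℤ)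
    (hn : ∀ j < r, 0 < n j ∧ n j < p) (hm : ∀ j < r, 0 < m j ∧ m j < q) :
    ∃ N : Matrix (Fin 2) (Fin 2) ℝ,
      ((((List.range r).map fun j => Sp p ^ n j * Uq q ^ m j).prod : SL2R) :
        Matrix (Fin 2) (Fin 2) ℝ) = (-1 : ℝ) ^ r • N ∧
      0 < N 0 0 ∧ 0 < N 1 1 ∧ N 0 1 ≤ 0 ∧ N 1 0 ≤ 0 := by
  induction r with
  | zero => exact ⟨1, by simp⟩
  | succ r ih =>
    obtain ⟨N, hN, a, d, b, c⟩ := ih (fun j hj => hn j (by omega)) (fun j hj => hm j (by omega))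
    obtain ⟨a', d', b', c'⟩ := block_signs p q hp hq _ _ (hn r (by omega)) (hm r (by omega))
    rw [List.range_succ, List.map_append, List.prod_append, SL2R_coe_mul, hN]
    simp only [List.map_cons, List.map_nil, List.prod_cons, List.prod_nil, mul_one]
    generalize ((Sp p ^ n r * Uq q ^ m r : SL2R) : Matrix (Fin 2) (Fin 2) ℝ) = B at *
    refine ⟨-(N * B), by simp [pow_succ], ?_⟩
    simp only [Matrix.neg_apply, Matrix.mul_apply, Fin.sum_univ_two]
    refine ⟨?_, ?_, ?_, ?_⟩ <;> nlinarith

/-- Sign pattern of the entries of `M = S_p^{n₁} U_q^{m₁} ⋯ S_p^{n_r} U_q^{m_r}`. -/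
theorem entries_sign_prod (p q : ℕ) (hp : 2 ≤ p) (hpq : p < q) (hco : Nat.Coprime p q)
    (r : ℕ) (hr : 1 ≤ r) (n m : ℕ → ℤ)
    (hn : ∀ j < r, 0 < n j ∧ n j < p) (hm : ∀ j < r, 0 < m j ∧ m j < q)
    (M : SL2R) (hM : M = ((List.range r).map fun j => Sp p ^ n j * Uq q ^ m j).prod) :
    (Odd r →
      (M : Matrix (Fin 2) (Fin 2) ℝ) 0 0 < 0 ∧ (M : Matrix (Fin 2) (Fin 2) ℝ) 1 1 < 0 ∧
      0 ≤ (M : Matrix (Fin 2) (Fin 2) ℝ) 0 1 ∧ 0 ≤ (M : Matrix (Fin 2) (Fin 2) ℝ) 1 0) ∧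
    (Even r →
      0 < (M : Matrix (Fin 2) (Fin 2) ℝ) 0 0 ∧ 0 < (M : Matrix (Fin 2) (Fin 2) ℝ) 1 1 ∧
      (M : Matrix (Fin 2) (Fin 2) ℝ) 0 1 ≤ 0 ∧ (M : Matrix (Fin 2) (Fin 2) ℝ) 1 0 ≤ 0) := by
  obtain ⟨N, hN, a, d, b, c⟩ := prod_signs p q hp (by omega) r n m hn hm
  rw [← hM] at hN
  rw [hN]
  constructor
  · intro h
    simp [h.neg_one_pow, a, b, c, d]
  · intro h
    simp [h.neg_one_pow, a, b, c, d]
end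

section
/- Let M = [[a, b], [c, d]] ∈ SL₂(ℝ) with a < 0, d < 0, b ≥ 0, c ≥ 0, and let n, m be integers with 0 < n < p and 0 < m < q. Then the product M·S_p^n U_q^m has both diagonal entries strictly positive and both off-diagonal entries ≤ 0; in particular tr(M·S_p^n U_q^m) > 0. -/
open Matrix Real

theorem sin_mul_div_nonneg (p k : ℕ) (hp : 2 ≤ p) (hk : k ≤ p) :
    0 ≤ Real.sin (k * (π / p)) / Real.sin (π / p) := by
  have hp' : (0 : ℝ) < p := by positivity
  have h1 : (k : ℝ) ≤ p := by exact_mod_cast hk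
  have h2 : (k : ℝ) * (π / p) ≤ π := by
    rw [mul_div_assoc', div_le_iff₀ hp']; nlinarith [Real.pi_pos]
  have h3 : π / p ≤ π := by
    apply div_le_self Real.pi_pos.le; exact_mod_cast (by omega : 1 ≤ p)
  exact div_nonneg (Real.sin_nonneg_of_nonneg_of_le_pi (by positivity) h2)
    (Real.sin_nonneg_of_nonneg_of_le_pi (by positivity) h3)

theorem sin_base_pos (p k : ℕ) (hk0 : 0 < k) (hk : k < p) :
    0 < Real.sin (k * (π / p)) := by
  have hp' : (0 : ℝ) < p := by exact_mod_cast (by omega : 0 < p)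
  have h1 : (k : ℝ) < p := by exact_mod_cast hk
  have h0 : (0 : ℝ) < k := by exact_mod_cast hk0
  have h2 : (k : ℝ) * (π / p) < π := by
    rw [mul_div_assoc', div_lt_iff₀ hp']; nlinarith [Real.pi_pos]
  exact Real.sin_pos_of_pos_of_lt_pi (by positivity) h2

theorem sin_rec (k : ℕ) (t : ℝ) :
    Real.sin ((k + 1 + 1 : ℕ) * t) = 2 * Real.cos t * Real.sin ((k + 1 : ℕ) * t)
      - Real.sin (k * t) := by
  have h1 : ((k + 1 + 1 : ℕ) : ℝ) * t = (k + 1 : ℕ) * t + t := by push_cast; ring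
  have h2 : (k : ℝ) * t = (k + 1 : ℕ) * t - t := by push_cast; ring
  rw [h1, h2, Real.sin_add, Real.sin_sub]; ring

theorem Sp_pow (p k : ℕ) (hs : Real.sin (π / p) ≠ 0) :
    ((Sp p ^ (k + 1) : SL2R) : Matrix (Fin 2) (Fin 2) ℝ) =
      !![-(Real.sin (k * (π / p)) / Real.sin (π / p)),
         -(Real.sin ((k + 1 : ℕ) * (π / p)) / Real.sin (π / p));
         Real.sin ((k + 1 : ℕ) * (π / p)) / Real.sin (π / p),
         Real.sin ((k + 1 + 1 : ℕ) * (π / p)) / Real.sin (π / p)] := by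
  induction k with
  | zero =>
    have := sin_rec 0 (π / p)
    rw [this, zero_add, pow_one]
    simp [Sp, hs]
  | succ k ih =>
    rw [pow_succ, Matrix.SpecialLinearGroup.coe_mul, ih, sin_rec (k + 1), sin_rec k]
    ext i j
    fin_cases i <;> fin_cases j <;> simp [Sp, Matrix.mul_apply, Fin.sum_univ_two] <;> ring

theorem Uq_pow (p k : ℕ) (hs : Real.sin (π / p) ≠ 0) :
    ((Uq p ^ (k + 1) : SL2R) : Matrix (Fin 2) (Fin 2) ℝ) =
      !![Real.sin ((k + 1 + 1 : ℕ) * (π / p)) / Real.sin (π / p),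
         -(Real.sin ((k + 1 : ℕ) * (π / p)) / Real.sin (π / p));
         Real.sin ((k + 1 : ℕ) * (π / p)) / Real.sin (π / p),
         -(Real.sin (k * (π / p)) / Real.sin (π / p))] := by
  induction k with
  | zero =>
    have := sin_rec 0 (π / p)
    rw [this, zero_add, pow_one]
    simp [Uq, hs]
  | succ k ih =>
    rw [pow_succ, Matrix.SpecialLinearGroup.coe_mul, ih, sin_rec (k + 1), sin_rec k]
    ext i j
    fin_cases i <;> fin_cases j <;> simp [Uq, Matrix.mul_apply, Fin.sum_univ_two] <;> ring

theorem Sp_zpow_form (p : ℕ) (hp : 2 ≤ p) (n : ℤ) (h0 : 0 < n) (h1 : n < p) :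
    ∃ x y z : ℝ, 0 ≤ x ∧ 0 < y ∧ 0 ≤ z ∧
      ((Sp p ^ n : SL2R) : Matrix (Fin 2) (Fin 2) ℝ) = !![-x, -y; y, z] := by
  obtain ⟨k, rfl⟩ : ∃ k : ℕ, n = (k + 1 : ℕ) := ⟨(n - 1).toNat, by omega⟩
  have hs : 0 < Real.sin (π / p) := by
    simpa using sin_base_pos p 1 one_pos (by omega)
  refine ⟨_, _, _, sin_mul_div_nonneg p k hp (by omega),
    div_pos (sin_base_pos p (k + 1) (by omega) (by omega)) hs,
    sin_mul_div_nonneg p (k + 1 + 1) hp (by omega), ?_⟩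
  rw [zpow_natCast]
  exact Sp_pow p k hs.ne'

theorem Uq_zpow_form (p : ℕ) (hp : 2 ≤ p) (n : ℤ) (h0 : 0 < n) (h1 : n < p) :
    ∃ x y z : ℝ, 0 ≤ x ∧ 0 < y ∧ 0 ≤ z ∧
      ((Uq p ^ n : SL2R) : Matrix (Fin 2) (Fin 2) ℝ) = !![z, -y; y, -x] := by
  obtain ⟨k, rfl⟩ : ∃ k : ℕ, n = (k + 1 : ℕ) := ⟨(n - 1).toNat, by omega⟩
  have hs : 0 < Real.sin (π / p) := by
    simpa using sin_base_pos p 1 one_pos (by omega)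
  refine ⟨_, _, _, sin_mul_div_nonneg p k hp (by omega),
    div_pos (sin_base_pos p (k + 1) (by omega) (by omega)) hs,
    sin_mul_div_nonneg p (k + 1 + 1) hp (by omega), ?_⟩
  rw [zpow_natCast]
  exact Uq_pow p k hs.ne'

/-- If the diagonal entries of `M` are negative and its off-diagonal entries nonnegative,
then `M S_p^n U_q^m` has positive diagonal entries and nonpositive off-diagonal entries;
in particular its trace is positive. -/
theorem mul_Sp_Uq_entries (p q : ℕ) (hp : 2 ≤ p) (hpq : p < q) (hco : Nat.Coprime p q)
    (M : SL2R)
    (ha : (M : Matrix (Fin 2) (Fin 2) ℝ) 0 0 < 0) (hd : (M : Matrix (Fin 2) (Fin 2) ℝ) 1 1 < 0)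
    (hb : 0 ≤ (M : Matrix (Fin 2) (Fin 2) ℝ) 0 1) (hc : 0 ≤ (M : Matrix (Fin 2) (Fin 2) ℝ) 1 0)
    (n m : ℤ) (hn0 : 0 < n) (hnp : n < p) (hm0 : 0 < m) (hmq : m < q) :
    (0 < ((M * (Sp p ^ n * Uq q ^ m) : SL2R) : Matrix (Fin 2) (Fin 2) ℝ) 0 0 ∧
      0 < ((M * (Sp p ^ n * Uq q ^ m) : SL2R) : Matrix (Fin 2) (Fin 2) ℝ) 1 1 ∧
      ((M * (Sp p ^ n * Uq q ^ m) : SL2R) : Matrix (Fin 2) (Fin 2) ℝ) 0 1 ≤ 0 ∧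
      ((M * (Sp p ^ n * Uq q ^ m) : SL2R) : Matrix (Fin 2) (Fin 2) ℝ) 1 0 ≤ 0) ∧
    0 < Matrix.trace ((M * (Sp p ^ n * Uq q ^ m) : SL2R) : Matrix (Fin 2) (Fin 2) ℝ) := by
  obtain ⟨x, y, z, hx, hy, hz, hS⟩ := Sp_zpow_form p hp n hn0 hnp
  obtain ⟨u, v, w, hu, hv, hw, hU⟩ := Uq_zpow_form q (by omega) m hm0 hmq
  have hT00 : 0 < x * w + y * v := by positivity
  have hT01 : 0 ≤ x * v + y * u := by positivity
  have hT10 : 0 ≤ y * w + z * v := by positivity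
  have hT11 : 0 < y * v + z * u := by positivity
  rw [Matrix.trace_fin_two]
  simp only [Matrix.SpecialLinearGroup.coe_mul, hS, hU]
  generalize (M : Matrix (Fin 2) (Fin 2) ℝ) = N at *
  simp only [Matrix.mul_apply, Fin.sum_univ_two, Matrix.of_apply, Matrix.cons_val', Matrix.cons_val_zero,
    Matrix.cons_val_one, Matrix.cons_val_fin_one]
  have e1 := mul_pos_of_neg_of_neg ha (neg_lt_zero.mpr hT00)
  have e2 := mul_nonneg hb hT10
  have e3 := mul_nonpos_of_nonpos_of_nonneg ha.le hT01
  have e4 := mul_nonneg hb hT11.le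
  have e5 := mul_nonneg hc hT00.le
  have e6 := mul_nonpos_of_nonpos_of_nonneg hd.le hT10
  have e7 := mul_nonneg hc hT01
  have e8 := mul_pos_of_neg_of_neg hd (neg_lt_zero.mpr hT11)
  refine ⟨⟨?_, ?_, ?_, ?_⟩, ?_⟩ <;> linarith
end

section
/- Suppose ψ : Γ_{p,q} → ℤ satisfies ψ(γ₁γ₂) = ψ(γ₁) + ψ(γ₂) + 2pq·W(γ₁, γ₂) for all γ₁, γ₂ ∈ Γ_{p,q}. Then ψ(S_p) = -q and ψ(U_q) = -p. -/
open Matrix Real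

/-- Sine formula for the powers of an elliptic element. -/
theorem pow_formula (A : Matrix (Fin 2) (Fin 2) ℝ) (t : ℝ)
    (hA : A * A = (2 * Real.cos t) • A - 1) (k : ℕ) :
    Real.sin t • A ^ k = Real.sin (k * t) • A - Real.sin (k * t - t) • (1 : Matrix (Fin 2) (Fin 2) ℝ) := by
  induction k with
  | zero => simp
  | succ k ih =>
    rw [pow_succ, ← smul_mul_assoc, ih, sub_mul, smul_mul_assoc, hA, smul_mul_assoc, one_mul]
    have h1 : ((k + 1 : ℕ) : ℝ) * t = k * t + t := by push_cast; ring
    rw [h1, add_sub_cancel_right, smul_sub, smul_smul, sub_right_comm, ← sub_smul]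
    congr 2
    rw [Real.sin_add, Real.sin_sub]; ring

theorem psi_elliptic (p q n : ℕ) (hn : 2 ≤ n) (H : Subgroup SL2R)
    (ψ : H → ℤ)
    (hψ : ∀ γ₁ γ₂ : H,
      (ψ (γ₁ * γ₂) : ℝ) = ψ γ₁ + ψ γ₂ + 2 * p * q * W (γ₁ : SL2R) (γ₂ : SL2R))
    (g : H) (h10 : (g : SL2R).1 1 0 = 1)
    (hA : (g : SL2R).1 * (g : SL2R).1 = (2 * Real.cos (π / n)) • (g : SL2R).1 - 1) :
    (n : ℝ) * ψ g = - (p * q) := by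
  have hn0 : (0 : ℝ) < n := by exact_mod_cast (by omega : 0 < n)
  have ht0 : 0 < π / n := by positivity
  have hnt : (n : ℝ) * (π / n) = π := by field_simp
  have htpi : π / n < π := by
    have : (2 : ℝ) ≤ n := by exact_mod_cast hn
    nlinarith [Real.pi_pos]
  have hs : 0 < Real.sin (π / n) := Real.sin_pos_of_pos_of_lt_pi ht0 htpi
  have hpow := pow_formula (g : SL2R).1 (π / n) hA
  have hsg : ∀ k : ℕ, 1 ≤ k → k < n → sgn ((g : SL2R) ^ k) = 1 := by
    intro k hk hkn
    have hk0 : (0 : ℝ) < k := by exact_mod_cast hk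
    have hkn' : (k : ℝ) < n := by exact_mod_cast hkn
    have hpos : 0 < Real.sin (k * (π / n)) := by
      apply Real.sin_pos_of_pos_of_lt_pi (by positivity)
      nlinarith
    have h := congrFun (congrFun (hpow k) 1) 0
    simp [h10] at h
    have h2 : 0 < ((g : SL2R).1 ^ k) 1 0 := by
      by_contra hcon
      push Not at hcon
      nlinarith
    have h3 : 0 < ((g : SL2R) ^ k).1 1 0 := by
      simpa using h2
    unfold sgn
    rw [if_pos h3.ne', Real.sign_of_pos h3]
  have hneg : (g : SL2R) ^ n = -1 := by
    have h := hpow n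
    rw [hnt, Real.sin_pi, Real.sin_pi_sub, zero_smul, zero_sub, ← smul_neg] at h
    have h2 := smul_right_injective _ hs.ne' h
    apply Subtype.ext
    simpa using h2
  have sg1 : sgn (1 : SL2R) = 1 := by simp [sgn, Real.sign_one]
  have sgm : sgn (-1 : SL2R) = -1 := by
    simp [sgn, Real.sign_neg, Real.sign_one]
  have e1 : (ψ 1 : ℝ) = 0 := by
    have h := hψ 1 1
    simp only [mul_one, W, OneMemClass.coe_one, sg1] at h
    linarith
  have e2 : (ψ (g ^ n) : ℝ) = p * q := by
    have h := hψ (g ^ n) (g ^ n)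
    have hsq : g ^ n * g ^ n = 1 := by
      apply Subtype.ext
      simp [hneg]
    rw [hsq, e1, SubmonoidClass.coe_pow, hneg] at h
    simp only [W, sgm, neg_mul_neg, mul_one, sg1] at h
    linarith
  have e3 : ∀ k : ℕ, 1 ≤ k → k < n → (ψ (g ^ k) : ℝ) = k * ψ g := by
    intro k hk
    induction k, hk using Nat.le_induction with
    | base => simp
    | succ k hk ih =>
      intro hkn
      have h := hψ (g ^ k) g
      have s1 := hsg 1 le_rfl (by omega)
      rw [pow_one] at s1
      rw [← pow_succ, ih (by omega), SubmonoidClass.coe_pow, W, ← pow_succ, hsg k hk (by omega), s1,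
        hsg (k + 1) (by omega) hkn] at h
      rw [h]; push_cast; ring
  obtain ⟨m, rfl⟩ : ∃ m, n = m + 1 := ⟨n - 1, by omega⟩
  have h := hψ (g ^ m) g
  have s1 := hsg 1 le_rfl (by omega)
  rw [pow_one] at s1
  rw [← pow_succ, e2, e3 m (by omega) (by omega), SubmonoidClass.coe_pow, W, ← pow_succ,
    hsg m (by omega) (by omega), s1, hneg, sgm] at h
  push_cast
  linarith

/-- If `ψ : Γ_{p,q} → ℤ` satisfies `ψ(γ₁γ₂) = ψ(γ₁) + ψ(γ₂) + 2pq·W(γ₁,γ₂)`, then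
`ψ(S_p) = -q` and `ψ(U_q) = -p`. -/
theorem psi_gen (p q : ℕ) (hp : 2 ≤ p) (hpq : p < q) (hco : Nat.Coprime p q)
    (ψ : TriangleGroup p q → ℤ)
    (hψ : ∀ γ₁ γ₂ : TriangleGroup p q,
      (ψ (γ₁ * γ₂) : ℝ) = ψ γ₁ + ψ γ₂ + 2 * p * q * W (γ₁ : SL2R) (γ₂ : SL2R)) :
    ψ ⟨Sp p, Subgroup.subset_closure (Set.mem_insert _ _)⟩ = -(q : ℤ) ∧
    ψ ⟨Uq q, Subgroup.subset_closure (Set.mem_insert_of_mem _ rfl)⟩ = -(p : ℤ) := by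
  have hp0 : (p : ℝ) ≠ 0 := by exact_mod_cast (by omega : p ≠ 0)
  have hq0 : (q : ℝ) ≠ 0 := by exact_mod_cast (by omega : q ≠ 0)
  constructor
  · have h := psi_elliptic p q p hp _ ψ hψ
      ⟨Sp p, Subgroup.subset_closure (Set.mem_insert _ _)⟩ (by simp [Sp]) (by
        ext i j
        fin_cases i <;> fin_cases j <;> simp [Sp, Matrix.mul_apply, Fin.sum_univ_two] <;> ring)
    rw [← mul_neg] at h
    exact_mod_cast mul_left_cancel₀ hp0 h
  · have h := psi_elliptic p q q (by omega) _ ψ hψ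
      ⟨Uq q, Subgroup.subset_closure (Set.mem_insert_of_mem _ rfl)⟩ (by simp [Uq]) (by
        ext i j
        fin_cases i <;> fin_cases j <;> simp [Uq, Matrix.mul_apply, Fin.sum_univ_two] <;> ring)
    rw [mul_comm (p : ℝ), ← mul_neg] at h
    exact_mod_cast mul_left_cancel₀ hq0 h
end

section
/- Suppose ψ : Γ_{p,q} → ℤ satisfies ψ(γ₁γ₂) = ψ(γ₁) + ψ(γ₂) + 2pq·W(γ₁, γ₂) for all γ₁, γ₂ ∈ Γ_{p,q}. Then for all integers n, m with 0 < n < p and 0 < m < q, the Rademacher symbol satisfies Ψ_{p,q}(S_p^n U_q^m) = pq - nq - mp. -/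
open Matrix Real

/-- The Rademacher symbol `Ψ_{p,q}(γ) = ψ(γ) + (pq/2)·sgn(γ)·(1 - sign(tr γ))` attached
to a function `ψ : Γ_{p,q} → ℤ`. -/
noncomputable def Psi (p q : ℕ) (ψ : TriangleGroup p q → ℤ) (γ : TriangleGroup p q) : ℝ :=
  (ψ γ : ℝ) + (p * q : ℝ) / 2 * sgn (γ : SL2R) *
    (1 - Real.sign (Matrix.trace ((γ : SL2R) : Matrix (Fin 2) (Fin 2) ℝ)))

theorem aux_Sp_pow (p : ℕ) (hs : Real.sin (π / p) ≠ 0) (k : ℕ) :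
    ((Sp p ^ k : SL2R) : Matrix (Fin 2) (Fin 2) ℝ) =
      !![-Real.sin ((k - 1) * (π / p)) / Real.sin (π / p), -Real.sin (k * (π / p)) / Real.sin (π / p);
        Real.sin (k * (π / p)) / Real.sin (π / p),
        Real.sin ((k + 1) * (π / p)) / Real.sin (π / p)] := by
  set a := π / (p : ℝ) with ha
  induction k with
  | zero =>
    ext i j
    fin_cases i <;> fin_cases j <;> simp [hs]
  | succ k ih =>
    rw [pow_succ, Matrix.SpecialLinearGroup.coe_mul, ih]
    have h1 : Real.sin (((k : ℝ) + 1 + 1) * a) =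
        2 * Real.cos a * Real.sin ((k + 1) * a) - Real.sin (k * a) := by
      have e1 : ((k : ℝ) + 1 + 1) * a = (k + 1) * a + a := by ring
      have e2 : (k : ℝ) * a = (k + 1) * a - a := by ring
      rw [e1, e2, Real.sin_add, Real.sin_sub]; ring
    have h2 : Real.sin (((k : ℝ) + 1) * a) =
        2 * Real.cos a * Real.sin (k * a) - Real.sin ((k - 1) * a) := by
      have e1 : ((k : ℝ) + 1) * a = k * a + a := by ring
      have e2 : ((k : ℝ) - 1) * a = k * a - a := by ring
      rw [e1, e2, Real.sin_add, Real.sin_sub]; ring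
    have h3 : ((k : ℝ) + 1 - 1) = k := by ring
    ext i j
    fin_cases i <;> fin_cases j <;>
      simp [Sp, Matrix.mul_apply, Fin.sum_univ_two, ← ha] <;>
      (first | done | (field_simp; done) | (rw [h1]; field_simp; try ring) | (rw [h2]; field_simp; try ring))

theorem aux_Uq_pow (q : ℕ) (hs : Real.sin (π / q) ≠ 0) (k : ℕ) :
    ((Uq q ^ k : SL2R) : Matrix (Fin 2) (Fin 2) ℝ) =
      !![Real.sin ((k + 1) * (π / q)) / Real.sin (π / q), -Real.sin (k * (π / q)) / Real.sin (π / q);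
        Real.sin (k * (π / q)) / Real.sin (π / q),
        -Real.sin ((k - 1) * (π / q)) / Real.sin (π / q)] := by
  set a := π / (q : ℝ) with ha
  induction k with
  | zero =>
    ext i j
    fin_cases i <;> fin_cases j <;> simp [hs]
  | succ k ih =>
    rw [pow_succ, Matrix.SpecialLinearGroup.coe_mul, ih]
    have h1 : Real.sin (((k : ℝ) + 1 + 1) * a) =
        2 * Real.cos a * Real.sin ((k + 1) * a) - Real.sin (k * a) := by
      have e1 : ((k : ℝ) + 1 + 1) * a = (k + 1) * a + a := by ring
      have e2 : (k : ℝ) * a = (k + 1) * a - a := by ring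
      rw [e1, e2, Real.sin_add, Real.sin_sub]; ring
    have h2 : Real.sin (((k : ℝ) + 1) * a) =
        2 * Real.cos a * Real.sin (k * a) - Real.sin ((k - 1) * a) := by
      have e1 : ((k : ℝ) + 1) * a = k * a + a := by ring
      have e2 : ((k : ℝ) - 1) * a = k * a - a := by ring
      rw [e1, e2, Real.sin_add, Real.sin_sub]; ring
    ext i j
    fin_cases i <;> fin_cases j <;>
      simp [Uq, Matrix.mul_apply, Fin.sum_univ_two, ← ha] <;>
      (first | done | (field_simp; done) | (rw [h1]; field_simp; try ring) | (rw [h2]; field_simp; try ring))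

theorem aux_sin_pos (N : ℕ) (k : ℝ) (h0 : 0 < k) (h1 : k < N) : 0 < Real.sin (k * (π / N)) := by
  have hN : (0 : ℝ) < N := h0.trans h1
  apply Real.sin_pos_of_pos_of_lt_pi
  · have := Real.pi_pos; positivity
  · rw [mul_div_assoc', div_lt_iff₀ hN, mul_comm]
    exact mul_lt_mul_of_pos_left h1 Real.pi_pos

theorem aux_sin_nonneg (N : ℕ) (hN : (0 : ℝ) < N) (k : ℝ) (h0 : 0 ≤ k) (h1 : k ≤ N) :
    0 ≤ Real.sin (k * (π / N)) := by
  apply Real.sin_nonneg_of_nonneg_of_le_pi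
  · have := Real.pi_pos; positivity
  · rw [mul_div_assoc', div_le_iff₀ hN, mul_comm]
    exact mul_le_mul_of_nonneg_left h1 Real.pi_pos.le

theorem aux_neg_one (N : ℕ) (hN : 2 ≤ N) (g : SL2R)
    (h : (g : Matrix (Fin 2) (Fin 2) ℝ) = !![-1, 0; 0, -1]) : sgn g = -1 ∧ g * g = 1 := by
  constructor
  · simp [sgn, h, Real.sign_of_neg]
  · ext i j
    rw [Matrix.SpecialLinearGroup.coe_mul, h]
    fin_cases i <;> fin_cases j <;> simp [Matrix.mul_apply, Fin.sum_univ_two]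

theorem aux_psi (p q : ℕ) (ψ : TriangleGroup p q → ℤ)
    (hψ : ∀ γ₁ γ₂ : TriangleGroup p q,
      (ψ (γ₁ * γ₂) : ℝ) = ψ γ₁ + ψ γ₂ + 2 * p * q * W (γ₁ : SL2R) (γ₂ : SL2R))
    (g : TriangleGroup p q) (N : ℕ) (hN : 2 ≤ N)
    (hpos : ∀ k : ℕ, 0 < k → k < N → sgn ((g : SL2R) ^ k) = 1)
    (hneg : sgn ((g : SL2R) ^ N) = -1) (hsq : (g : SL2R) ^ N * (g : SL2R) ^ N = 1)
    (k : ℕ) (hk0 : 0 < k) (hk : k < N) :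
    (N : ℝ) * ψ (g ^ k) = - (k * (p * q)) := by
  have s1 : sgn (1 : SL2R) = 1 := by simp [sgn]
  have hlin : ∀ k : ℕ, 0 < k → k < N → (ψ (g ^ k) : ℝ) = k * ψ g := by
    intro k hk0
    induction k, hk0 using Nat.le_induction with
    | base => intro _; simp
    | succ k hk0 ih =>
      intro hk
      have e := hψ (g ^ k) g
      rw [← pow_succ, ih (by omega)] at e
      have w : W ((g ^ k : TriangleGroup p q) : SL2R) (g : SL2R) = 0 := by
        have a1 := hpos k (by omega) (by omega)
        have a2 := hpos 1 (by omega) (by omega)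
        have a3 := hpos (k + 1) (by omega) (by omega)
        rw [pow_one] at a2
        rw [W, Subgroup.coe_pow, ← pow_succ, a1, a2, a3]; norm_num
      rw [e, w]; push_cast; ring
  have hlast : (ψ (g ^ N) : ℝ) = N * ψ g + 2 * p * q := by
    obtain ⟨M, rfl⟩ : ∃ M, N = M + 1 := ⟨N - 1, by omega⟩
    have e := hψ (g ^ M) g
    rw [← pow_succ, hlin M (by omega) (by omega)] at e
    have w : W ((g ^ M : TriangleGroup p q) : SL2R) (g : SL2R) = 1 := by
      have a1 := hpos M (by omega) (by omega)
      have a2 := hpos 1 (by omega) (by omega)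
      rw [pow_one] at a2
      rw [W, Subgroup.coe_pow, ← pow_succ, a1, a2, hneg]; norm_num
    rw [e, w]; push_cast; ring
  have hone : (ψ 1 : ℝ) = 0 := by
    have e := hψ 1 1
    have w : W ((1 : TriangleGroup p q) : SL2R) ((1 : TriangleGroup p q) : SL2R) = 0 := by
      rw [W, Subgroup.coe_one, mul_one, s1]; norm_num
    rw [w, mul_one] at e
    linarith
  have hsqr : (ψ (g ^ N) : ℝ) = p * q := by
    have e := hψ (g ^ N) (g ^ N)
    have h1 : g ^ N * g ^ N = 1 := by
      apply Subtype.ext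
      simpa using hsq
    have w : W ((g ^ N : TriangleGroup p q) : SL2R) ((g ^ N : TriangleGroup p q) : SL2R) = -1 := by
      rw [W, Subgroup.coe_pow, hsq, hneg, s1]; norm_num
    rw [h1, hone, w] at e
    linarith
  rw [hlin k hk0 hk]
  have : (N : ℝ) * ψ g = - (p * q) := by linarith
  linear_combination (k : ℝ) * this

/-- `Ψ_{p,q}(S_p^n U_q^m) = pq - nq - mp` for `0 < n < p` and `0 < m < q`. -/
theorem Psi_Sp_Uq (p q : ℕ) (hp : 2 ≤ p) (hpq : p < q) (hco : Nat.Coprime p q)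
    (ψ : TriangleGroup p q → ℤ)
    (hψ : ∀ γ₁ γ₂ : TriangleGroup p q,
      (ψ (γ₁ * γ₂) : ℝ) = ψ γ₁ + ψ γ₂ + 2 * p * q * W (γ₁ : SL2R) (γ₂ : SL2R))
    (n m : ℤ) (hn0 : 0 < n) (hnp : n < p) (hm0 : 0 < m) (hmq : m < q)
    (γ : TriangleGroup p q) (hγ : (γ : SL2R) = Sp p ^ n * Uq q ^ m) :
    Psi p q ψ γ = (p * q : ℝ) - n * q - m * p := by
  lift n to ℕ using hn0.le
  lift m to ℕ using hm0.le
  have hn0' : 0 < n := by exact_mod_cast hn0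
  have hm0' : 0 < m := by exact_mod_cast hm0
  have hnp' : n < p := by exact_mod_cast hnp
  have hmq' : m < q := by exact_mod_cast hmq
  have hp0 : (0 : ℝ) < p := by exact_mod_cast (by omega : 0 < p)
  have hq0 : (0 : ℝ) < q := by exact_mod_cast (by omega : 0 < q)
  have hn1R : (1 : ℝ) ≤ n := by exact_mod_cast hn0'
  have hm1R : (1 : ℝ) ≤ m := by exact_mod_cast hm0'
  have hnpR : (n : ℝ) + 1 ≤ p := by exact_mod_cast hnp'
  have hmqR : (m : ℝ) + 1 ≤ q := by exact_mod_cast hmq'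
  have hsa : 0 < Real.sin (π / p) := by
    simpa using aux_sin_pos p 1 one_pos (by linarith)
  have hsb : 0 < Real.sin (π / q) := by
    simpa using aux_sin_pos q 1 one_pos (by linarith)
  have hSm : Sp p ∈ TriangleGroup p q := Subgroup.subset_closure (by simp)
  have hUm : Uq q ∈ TriangleGroup p q := Subgroup.subset_closure (by simp)
  have hSpos : ∀ k : ℕ, 0 < k → k < p → sgn (Sp p ^ k) = 1 := by
    intro k h0 h1
    have h : 0 < Real.sin (k * (π / p)) / Real.sin (π / p) :=
      div_pos (aux_sin_pos p k (by exact_mod_cast h0) (by exact_mod_cast h1)) hsa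
    have e : ((Sp p ^ k : SL2R) : Matrix (Fin 2) (Fin 2) ℝ) 1 0 =
        Real.sin (k * (π / p)) / Real.sin (π / p) := by
      rw [aux_Sp_pow p hsa.ne' k]; simp
    rw [sgn, e, if_pos h.ne', Real.sign_of_pos h]
  have hUpos : ∀ k : ℕ, 0 < k → k < q → sgn (Uq q ^ k) = 1 := by
    intro k h0 h1
    have h : 0 < Real.sin (k * (π / q)) / Real.sin (π / q) :=
      div_pos (aux_sin_pos q k (by exact_mod_cast h0) (by exact_mod_cast h1)) hsb
    have e : ((Uq q ^ k : SL2R) : Matrix (Fin 2) (Fin 2) ℝ) 1 0 =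
        Real.sin (k * (π / q)) / Real.sin (π / q) := by
      rw [aux_Uq_pow q hsb.ne' k]; simp
    rw [sgn, e, if_pos h.ne', Real.sign_of_pos h]
  have hSN : ((Sp p ^ p : SL2R) : Matrix (Fin 2) (Fin 2) ℝ) = !![-1, 0; 0, -1] := by
    rw [aux_Sp_pow p hsa.ne' p]
    have e0 : (p : ℝ) * (π / p) = π := by field_simp
    have e1 : ((p : ℝ) - 1) * (π / p) = π - π / p := by rw [sub_mul, e0, one_mul]
    have e2 : ((p : ℝ) + 1) * (π / p) = π / p + π := by rw [add_mul, e0, one_mul, add_comm]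
    rw [e0, e1, e2, Real.sin_pi_sub, Real.sin_add_pi, Real.sin_pi, neg_div, div_self hsa.ne']
    simp
  have hUN : ((Uq q ^ q : SL2R) : Matrix (Fin 2) (Fin 2) ℝ) = !![-1, 0; 0, -1] := by
    rw [aux_Uq_pow q hsb.ne' q]
    have e0 : (q : ℝ) * (π / q) = π := by field_simp
    have e1 : ((q : ℝ) - 1) * (π / q) = π - π / q := by rw [sub_mul, e0, one_mul]
    have e2 : ((q : ℝ) + 1) * (π / q) = π / q + π := by rw [add_mul, e0, one_mul, add_comm]
    rw [e0, e1, e2, Real.sin_pi_sub, Real.sin_add_pi, Real.sin_pi, neg_div, div_self hsb.ne']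
    simp
  obtain ⟨hS1, hS2⟩ := aux_neg_one p hp _ hSN
  obtain ⟨hU1, hU2⟩ := aux_neg_one q (by omega) _ hUN
  have hψS := aux_psi p q ψ hψ ⟨Sp p, hSm⟩ p hp hSpos hS1 hS2 n hn0' hnp'
  have hψU := aux_psi p q ψ hψ ⟨Uq q, hUm⟩ q (by omega) hUpos hU1 hU2 m hm0' hmq'
  have hψS' : (ψ (⟨Sp p, hSm⟩ ^ n) : ℝ) = -(n * q) := by
    apply mul_left_cancel₀ hp0.ne'
    rw [hψS]; ring
  have hψU' : (ψ (⟨Uq q, hUm⟩ ^ m) : ℝ) = -(m * p) := by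
    apply mul_left_cancel₀ hq0.ne'
    rw [hψU]; ring
  rw [zpow_natCast, zpow_natCast] at hγ
  have hγ' : γ = (⟨Sp p, hSm⟩ ^ n : TriangleGroup p q) * (⟨Uq q, hUm⟩ ^ m : TriangleGroup p q) := by
    apply Subtype.ext
    rw [hγ]; simp
  have hval := hψ (⟨Sp p, hSm⟩ ^ n) (⟨Uq q, hUm⟩ ^ m)
  rw [← hγ', hψS', hψU', W, ← Subgroup.coe_mul, ← hγ', Subgroup.coe_pow, Subgroup.coe_pow,
    hSpos n hn0' hnp', hUpos m hm0' hmq'] at hval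
  have x1 := aux_sin_pos p n (by linarith) (by linarith)
  have x2 := aux_sin_pos q m (by linarith) (by linarith)
  have x3 := aux_sin_nonneg p hp0 (n - 1) (by linarith) (by linarith)
  have x4 := aux_sin_nonneg p hp0 (n + 1) (by linarith) (by linarith)
  have x5 := aux_sin_nonneg q hq0 (m - 1) (by linarith) (by linarith)
  have x6 := aux_sin_nonneg q hq0 (m + 1) (by linarith) (by linarith)
  have hmat : ((γ : SL2R) : Matrix (Fin 2) (Fin 2) ℝ) =
      ((Sp p ^ n : SL2R) : Matrix (Fin 2) (Fin 2) ℝ) * ((Uq q ^ m : SL2R) : Matrix (Fin 2) (Fin 2) ℝ) := by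
    rw [hγ, Matrix.SpecialLinearGroup.coe_mul]
  rw [aux_Sp_pow p hsa.ne', aux_Uq_pow q hsb.ne'] at hmat
  have hd : ((γ : SL2R) : Matrix (Fin 2) (Fin 2) ℝ) 1 1 < 0 := by
    have e : ((γ : SL2R) : Matrix (Fin 2) (Fin 2) ℝ) 1 1 =
        -((Real.sin (n * (π / p)) * Real.sin (m * (π / q)) +
          Real.sin ((n + 1) * (π / p)) * Real.sin ((m - 1) * (π / q))) /
          (Real.sin (π / p) * Real.sin (π / q))) := by
      rw [hmat]
      simp [Matrix.mul_apply, Fin.sum_univ_two]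
      field_simp
      ring
    rw [e]
    apply neg_neg_of_pos
    positivity
  have ha : ((γ : SL2R) : Matrix (Fin 2) (Fin 2) ℝ) 0 0 < 0 := by
    have e : ((γ : SL2R) : Matrix (Fin 2) (Fin 2) ℝ) 0 0 =
        -((Real.sin (n * (π / p)) * Real.sin (m * (π / q)) +
          Real.sin ((n - 1) * (π / p)) * Real.sin ((m + 1) * (π / q))) /
          (Real.sin (π / p) * Real.sin (π / q))) := by
      rw [hmat]
      simp [Matrix.mul_apply, Fin.sum_univ_two]
      field_simp
      ring
    rw [e]
    apply neg_neg_of_pos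
    positivity
  have htr : Real.sign (Matrix.trace ((γ : SL2R) : Matrix (Fin 2) (Fin 2) ℝ)) = -1 := by
    apply Real.sign_of_neg
    rw [Matrix.trace_fin_two]
    linarith
  rw [Psi, hval, htr]
  push_cast
  ring
end
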